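/- Let Y ⊆ ℝ^m be a feasible objective set, and let d, u ∈ ℝ^m satisfy u_i < d_i for all i. Define the benefit ratios r_i(y) = (d_i − y_i)/(d_i − u_i). Suppose y* ∈ Y is Pareto optimal in Y and all its benefit ratios are equal: r_1(y*) = r_2(y*) = ⋯ = r_m(y*). Then y* maximizes the smallest benefit ratio over all feasible points: for every y ∈ Y, min_{1 ≤ i ≤ m} r_i(y) ≤ min_{1 ≤ i ≤ m} r_i(y*). Consequently, when the intersection of the Pareto front with the line (d, u) is feasible, the Kalai–Smorodinsky solution y* and the efficient maxmin solution y** coincide. -/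

import Mathlib

/-- `y` is Pareto optimal in the feasible objective set `Y ⊆ ℝ^m`:
no feasible point weakly improves all coordinates and strictly improves one. -/
def ParetoOptimal {m : ℕ} (Y : Set (Fin m → ℝ)) (y : Fin m → ℝ) : Prop :=
  y ∈ Y ∧ ¬ ∃ z ∈ Y, (∀ i, z i ≤ y i) ∧ ∃ j, z j < y j

/-- If `y* ∈ Y` is Pareto optimal and all its benefit ratios
`r i y = (d i − y i)/(d i − u i)` are equal, then `y*` maximizes the smallest
benefit ratio over all feasible points; hence, when the intersection of the
Pareto front with the line `(d, u)` is feasible, the Kalai–Smorodinsky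
solution and the efficient maxmin solution coincide. -/
theorem KS_is_efficient_maxmin
    {m : ℕ} (hm : 1 ≤ m) (Y : Set (Fin m → ℝ)) (d u : Fin m → ℝ)
    (hdu : ∀ i, u i < d i)
    (r : (Fin m → ℝ) → Fin m → ℝ)
    (hr : ∀ y i, r y i = (d i - y i) / (d i - u i))
    (ystar : Fin m → ℝ)
    (hP : ParetoOptimal Y ystar)
    (heq : ∀ i j : Fin m, r ystar i = r ystar j) :
    ∀ y ∈ Y, (⨅ i : Fin m, r y i) ≤ ⨅ i : Fin m, r ystar i := by
  intro y hy
  have : Nonempty (Fin m) := ⟨⟨0, hm⟩⟩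
  by_contra! hlt
  have improves : ∀ i, y i < ystar i := by
    intro i
    have hconst : (⨅ j, r ystar j) = r ystar i := by
      simp only [heq _ i, ciInf_const]
    have hri : r ystar i < r y i :=
      hconst ▸ hlt.trans_le (ciInf_le (Set.finite_range _).bddBelow i)
    rw [hr, hr, div_lt_div_iff_of_pos_right (sub_pos.mpr (hdu i))] at hri
    linarith
  exact hP.2 ⟨y, hy, fun i => (improves i).le, ⟨0, hm⟩, improves _⟩
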